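/- arXiv:2302.13811 — 3 statements merged into one kernel-verified Lean document; each statement's English description precedes it below -/
import Mathlib

section
/- Let u0 and u1 be moment functionals on ℂ[x] with MOPS {P_n} and {R_n} respectively, let λ ≠ 0, and let {S_n} be an MOPS relative to the Sobolev form φ_λ. Assume relation (3.1): P_{n+1} − σ̃_n P_n − τ̃_{n−1} P_{n−1} = S_{n+1} − μ_n S_n − θ_{n−1} S_{n−1} for all n ≥ 0, and relation (3.3): (n+1)·R_n − d̃_n·R_{n−1} − ẽ_{n−1}·R_{n−2} = P′_{n+1} − σ̃_n·P′_n − τ̃_{n−1}·P′_{n−1} for all n ≥ 0 with d̃_0 = ẽ_0 = ẽ_{−1} = 0. Set p_n = ⟨u0, P_n²⟩, r_n = ⟨u1, R_n²⟩, s_n = φ_λ(S_n, S_n). Then for all n ≥ 2: θ_{n−1}·s_{n−1} = τ̃_{n−1}·p_{n−1} + (n−1)·λ·ẽ_{n−1}·r_{n−2}; equivalently ẽ_{n−1} = (θ_{n−1}s_{n−1} − τ̃_{n−1}p_{n−1}) / ((n−1)λ r_{n−2}). -/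
open Polynomial

noncomputable section

/-- A monic orthogonal polynomial system (MOPS) relative to a moment functional `u`,
indexed by `ℤ` with the convention `P n = 0` for `n < 0`. -/
def IsMOPS (u : Polynomial ℂ →ₗ[ℂ] ℂ) (P : ℤ → Polynomial ℂ) : Prop :=
  (∀ n : ℤ, n < 0 → P n = 0) ∧
  (∀ n : ℤ, 0 ≤ n → (P n).Monic ∧ (P n).natDegree = n.toNat) ∧
  (∀ m n : ℤ, 0 ≤ m → 0 ≤ n → m ≠ n → u (P m * P n) = 0) ∧
  (∀ n : ℤ, 0 ≤ n → u (P n ^ 2) ≠ 0)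

/-- The Sobolev bilinear form `φ_λ(f,g) = ⟨u0, f·g⟩ + λ·⟨u1, f'·g'⟩`. -/
def sobolev (u0 u1 : Polynomial ℂ →ₗ[ℂ] ℂ) (lam : ℂ) (f g : Polynomial ℂ) : ℂ :=
  u0 (f * g) + lam * u1 (derivative f * derivative g)

/-- An MOPS relative to the Sobolev form `φ_λ`. -/
def IsSobolevMOPS (u0 u1 : Polynomial ℂ →ₗ[ℂ] ℂ) (lam : ℂ) (S : ℤ → Polynomial ℂ) : Prop :=
  (∀ n : ℤ, n < 0 → S n = 0) ∧
  (∀ n : ℤ, 0 ≤ n → (S n).Monic ∧ (S n).natDegree = n.toNat) ∧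
  (∀ m n : ℤ, 0 ≤ m → 0 ≤ n → m ≠ n → sobolev u0 u1 lam (S m) (S n) = 0) ∧
  (∀ n : ℤ, 0 ≤ n → sobolev u0 u1 lam (S n) (S n) ≠ 0)

/-- Pairing `P k` with a polynomial of degree at most `k` reads off its `k`-th coefficient. -/
theorem IsMOPS.apply_mul_eq_coeff {u : Polynomial ℂ →ₗ[ℂ] ℂ} {P : ℤ → Polynomial ℂ}
    (hP : IsMOPS u P) (N : ℕ) :
    ∀ q : Polynomial ℂ, q.degree < N → ∀ k : ℕ, N ≤ k + 1 →
      u (P k * q) = q.coeff k * u (P k ^ 2) := by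
  obtain ⟨-, hmon, horth, -⟩ := hP
  have hdeg (n : ℕ) : (P n).natDegree = n := by simpa using (hmon n (by simp)).2
  have hcoeff (n : ℕ) : (P n).coeff n = 1 := by
    have h := (hmon n (by simp)).1.coeff_natDegree
    rwa [hdeg n] at h
  induction N with
  | zero =>
    intro q hq k _
    have : q = 0 := by
      rw [← degree_eq_bot]
      simpa [Nat.WithBot.lt_zero_iff] using hq
    simp [this]
  | succ N ih =>
    intro q hq k hk
    have hbase : u (P k * P N) = (P N).coeff k * u (P k ^ 2) := by
      rcases eq_or_ne k N with rfl | hne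
      · rw [hcoeff, one_mul, pow_two]
      · rw [horth k N (by simp) (by simp) (by exact_mod_cast hne),
          coeff_eq_zero_of_natDegree_lt (by rw [hdeg]; omega), zero_mul]
    have hlow : (q - q.coeff N • P N).degree < N := by
      rw [degree_lt_iff_coeff_zero] at hq ⊢
      intro m hm
      rcases eq_or_ne m N with rfl | hne
      · simp [hcoeff]
      · rw [coeff_sub, coeff_smul, hq m (by omega),
          coeff_eq_zero_of_natDegree_lt (p := P N) (by rw [hdeg]; omega)]
        simp
    have hrec := ih _ hlow k (by omega)
    rw [mul_sub, mul_smul_comm, map_sub, map_smul, hbase, coeff_sub, coeff_smul] at hrec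
    simp only [smul_eq_mul] at hrec
    linear_combination hrec

/-- The Sobolev form is linear in its first argument, on three-term combinations. -/
theorem sobolev_sub_smul_sub_smul (u0 u1 : Polynomial ℂ →ₗ[ℂ] ℂ) (lam a b : ℂ)
    (f g h k : Polynomial ℂ) :
    sobolev u0 u1 lam (f - a • g - b • h) k =
      sobolev u0 u1 lam f k - a * sobolev u0 u1 lam g k - b * sobolev u0 u1 lam h k := by
  simp only [sobolev, sub_mul, smul_mul_assoc, map_sub,
    map_smul, smul_eq_mul]
  ring

theorem stmt2
    (u0 u1 : Polynomial ℂ →ₗ[ℂ] ℂ) (lam : ℂ) (hlam : lam ≠ 0)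
    (P R S : ℤ → Polynomial ℂ)
    (hP : IsMOPS u0 P) (hR : IsMOPS u1 R) (hS : IsSobolevMOPS u0 u1 lam S)
    (σ' τ' μ θ : ℤ → ℂ) (hτ' : τ' (-1) = 0) (hθ : θ (-1) = 0)
    (h31 : ∀ n : ℤ, 0 ≤ n →
      P (n + 1) - σ' n • P n - τ' (n - 1) • P (n - 1)
        = S (n + 1) - μ n • S n - θ (n - 1) • S (n - 1))
    (d' e' : ℤ → ℂ) (hd'0 : d' 0 = 0) (he'0 : e' 0 = 0) (he'm : e' (-1) = 0)
    (h33 : ∀ n : ℤ, 0 ≤ n →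
      ((n : ℂ) + 1) • R n - d' n • R (n - 1) - e' (n - 1) • R (n - 2)
        = derivative (P (n + 1)) - σ' n • derivative (P n)
          - τ' (n - 1) • derivative (P (n - 1)))
    (p r s : ℤ → ℂ)
    (hp : ∀ n : ℤ, p n = u0 (P n ^ 2))
    (hr : ∀ n : ℤ, r n = u1 (R n ^ 2))
    (hs : ∀ n : ℤ, s n = sobolev u0 u1 lam (S n) (S n)) :
    ∀ n : ℤ, 2 ≤ n →
      θ (n - 1) * s (n - 1)
          = τ' (n - 1) * p (n - 1) + ((n : ℂ) - 1) * lam * e' (n - 1) * r (n - 2) ∧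
      e' (n - 1)
          = (θ (n - 1) * s (n - 1) - τ' (n - 1) * p (n - 1))
              / (((n : ℂ) - 1) * lam * r (n - 2)) := by
  intro n hn
  obtain ⟨m, rfl⟩ : ∃ m : ℕ, n = (m : ℤ) + 2 := ⟨(n - 2).toNat, by omega⟩
  have e2 : (m : ℤ) + 2 = ((m + 2 : ℕ) : ℤ) := by push_cast; ring
  have e3 : ((m + 2 : ℕ) : ℤ) - 1 = ((m + 1 : ℕ) : ℤ) := by push_cast; ring
  have e4 : ((m + 2 : ℕ) : ℤ) - 2 = (m : ℤ) := by push_cast; ring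
  have e5 : ((m + 2 : ℕ) : ℤ) + 1 = ((m + 3 : ℕ) : ℤ) := by push_cast; ring
  have hc : (((m : ℤ) + 2 : ℤ) : ℂ) - 1 = (m : ℂ) + 1 := by push_cast; ring
  have h1 := h31 (m + 2) (by omega)
  have h3 := h33 (m + 2) (by omega)
  rw [hc]
  simp only [e2, e3, e4, e5] at h1 h3 ⊢
  obtain ⟨hSmon, hSdeg⟩ := hS.2.1 (m + 1 : ℕ) (by omega)
  rw [Int.toNat_natCast] at hSdeg
  have hScoeff : (S (m + 1 : ℕ)).coeff (m + 1) = 1 := by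
    rw [← hSmon.coeff_natDegree, hSdeg]
  have hSlt : (S (m + 1 : ℕ)).degree < (m + 2 : ℕ) := by
    rw [degree_eq_natDegree hSmon.ne_zero, hSdeg]
    exact_mod_cast Nat.lt_succ_self _
  have hDlt : (derivative (S (m + 1 : ℕ))).degree < (m + 1 : ℕ) := by
    have h := degree_derivative_lt hSmon.ne_zero
    rwa [degree_eq_natDegree hSmon.ne_zero, hSdeg] at h
  have hS0 (k : ℕ) (hk : m + 1 < k) : (S (m + 1 : ℕ)).coeff k = 0 :=
    coeff_eq_zero_of_natDegree_lt (by omega)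
  have hP' (k : ℕ) (hk : m + 1 ≤ k) := hP.apply_mul_eq_coeff _ _ hSlt k (by omega)
  have hR' (k : ℕ) (hk : m ≤ k) := hR.apply_mul_eq_coeff _ _ hDlt k (by omega)
  have hleft : sobolev u0 u1 lam
      (S (m + 3 : ℕ) - μ (m + 2 : ℕ) • S (m + 2 : ℕ) - θ (m + 1 : ℕ) • S (m + 1 : ℕ))
      (S (m + 1 : ℕ)) = -(θ (m + 1 : ℕ) * s (m + 1 : ℕ)) := by
    rw [sobolev_sub_smul_sub_smul, hs, hS.2.2.1 _ _ (by omega) (by omega) (by omega),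
      hS.2.2.1 (m + 2 : ℕ) _ (by omega) (by omega) (by omega)]
    ring
  have hright : sobolev u0 u1 lam
      (P (m + 3 : ℕ) - σ' (m + 2 : ℕ) • P (m + 2 : ℕ) - τ' (m + 1 : ℕ) • P (m + 1 : ℕ))
      (S (m + 1 : ℕ)) =
      -(τ' (m + 1 : ℕ) * p (m + 1 : ℕ)) - lam * (e' (m + 1 : ℕ) * ((m + 1) * r m)) := by
    rw [sobolev, derivative_sub, derivative_sub, derivative_smul, derivative_smul, ← h3]
    simp only [sub_mul, smul_mul_assoc, map_sub, map_smul, smul_eq_mul]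
    rw [hP' (m + 3) (by omega), hP' (m + 2) (by omega), hP' (m + 1) le_rfl,
      hR' (m + 2) (by omega), hR' (m + 1) (by omega), hR' m le_rfl,
      coeff_derivative, coeff_derivative, coeff_derivative,
      hS0 (m + 3) (by omega), hS0 (m + 2) (by omega),
      hScoeff, hp, hr]
    ring
  have hmain : θ (m + 1 : ℕ) * s (m + 1 : ℕ) = τ' (m + 1 : ℕ) * p (m + 1 : ℕ) +
      ((m : ℂ) + 1) * lam * e' (m + 1 : ℕ) * r m := by
    rw [h1, hleft] at hright
    linear_combination -hright
  have hr0 : r m ≠ 0 := by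
    rw [hr]
    exact hR.2.2.2 m (by omega)
  have hm0 : (m : ℂ) + 1 ≠ 0 := by exact_mod_cast Nat.succ_ne_zero m
  refine ⟨hmain, ?_⟩
  rw [eq_div_iff (mul_ne_zero (mul_ne_zero hm0 hlam) hr0)]
  linear_combination -hmain
end
end

section
/- Let u0 and u1 be moment functionals on ℂ[x] with MOPS {P_n} and {R_n} respectively, set Q_n = P′_{n+1}/(n+1), and assume {Q_n} is an MOPS relative to some moment functional u (as holds when u0 is classical with u = φ·u0, or when u1 is strongly classical). Assume the extended generalized coherence relation (3.9): R_n − d_{n−1}R_{n−1} − e_{n−2}R_{n−2} = Q_n − σ_{n−1}Q_{n−1} − τ_{n−2}Q_{n−2} for all n ≥ 0, with d_{−1} = e_{−1} = e_{−2} = σ_{−1} = τ_{−1} = τ_{−2} = 0. If σ_0 = d_0 and τ_0 = e_0, then R_n = Q_n for all n ≥ 0, and σ_n = d_n and τ_n = e_n for all n ≥ 1. -/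
open Polynomial

noncomputable section

theorem LinearMap.eq_zero_of_degree_lt_of_monic_sequence {v : ℂ[X] →ₗ[ℂ] ℂ} {S : ℕ → ℂ[X]}
    (hS : ∀ n, (S n).Monic ∧ (S n).natDegree = n) {n : ℕ} (hv : ∀ m < n, v (S m) = 0)
    {p : ℂ[X]} (hp : p.degree < n) : v p = 0 := by
  induction n generalizing p with
  | zero =>
    have : p = 0 := by simpa using hp
    simp [this]
  | succ n ih =>
    have hlt : (p - p.coeff n • S n).degree < n := by
      rw [degree_lt_iff_coeff_zero] at hp ⊢
      intro k hk
      rcases hk.eq_or_lt with rfl | hk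
      · have : (S n).coeff n = 1 := by
          simpa [Monic, leadingCoeff, (hS n).2] using (hS n).1
        simp [this]
      · have : (S n).coeff k = 0 := coeff_eq_zero_of_natDegree_lt (by rwa [(hS n).2])
        simp [this, hp k hk]
    have h := ih (fun m hm => hv m (by lia)) hlt
    simpa [hv n (by lia)] using h

namespace IsMOPS

variable {u : ℂ[X] →ₗ[ℂ] ℂ} {P R : ℤ → ℂ[X]}

theorem monic_natDegree_natCast (h : IsMOPS u P) (n : ℕ) :
    (P n).Monic ∧ (P n).natDegree = n := by
  simpa using h.2.1 n (by lia)

theorem apply_zero (h : IsMOPS u P) : P 0 = 1 := by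
  have := h.monic_natDegree_natCast 0
  exact this.1.natDegree_eq_zero.mp this.2

theorem map_apply (h : IsMOPS u P) (n : ℤ) : u (P n) = if n = 0 then u 1 else 0 := by
  split_ifs with hn
  · rw [hn, h.apply_zero]
  · rcases lt_or_ge n 0 with hneg | hpos
    · simp [h.1 n hneg]
    · simpa [h.apply_zero] using h.2.2.1 n 0 hpos le_rfl hn

theorem map_one_ne_zero (h : IsMOPS u P) : u 1 ≠ 0 := by
  simpa [h.apply_zero] using h.2.2.2 0 le_rfl

theorem map_mul_eq_zero (h : IsMOPS u P) {n : ℕ} {p : ℂ[X]} (hp : p.degree < n) :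
    u (P n * p) = 0 :=
  LinearMap.eq_zero_of_degree_lt_of_monic_sequence (v := u ∘ₗ LinearMap.mulLeft ℂ (P n))
    h.monic_natDegree_natCast
    (fun m hm => by simpa using h.2.2.1 n m (by lia) (by lia) (by lia)) hp

theorem smul (h : IsMOPS u P) {c : ℂ} (hc : c ≠ 0) : IsMOPS (c • u) P := by
  refine ⟨h.1, h.2.1, fun m n hm hn hmn => ?_, fun n hn => ?_⟩
  · simp [h.2.2.1 m n hm hn hmn]
  · simpa [hc] using h.2.2.2 n hn

/-- A moment functional has at most one monic orthogonal polynomial system. -/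
theorem unique (hP : IsMOPS u P) (hR : IsMOPS u R) (n : ℕ) : P n = R n := by
  by_contra hne
  set w := P n - R n with hw
  have hw0 : w ≠ 0 := sub_ne_zero.mpr hne
  obtain ⟨hPm, hPd⟩ := hP.monic_natDegree_natCast n
  obtain ⟨hRm, hRd⟩ := hR.monic_natDegree_natCast n
  have hwdeg : w.degree < n := by
    have hdeg : (P n).degree = n := by rw [degree_eq_natDegree hPm.ne_zero, hPd]
    rw [← hdeg]
    refine degree_sub_lt_left ?_ hPm.ne_zero (by rw [hPm, hRm])
    rw [hdeg, degree_eq_natDegree hRm.ne_zero, hRd]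
  set m := w.natDegree with hm
  have hmw : w.degree = m := degree_eq_natDegree hw0
  obtain ⟨hQm, hQd⟩ := hP.monic_natDegree_natCast m
  have hQdeg : (P m).degree = m := by rw [degree_eq_natDegree hQm.ne_zero, hQd]
  have hlow : (w - w.leadingCoeff • P m).degree < m := by
    have hlc : w.leadingCoeff ≠ 0 := leadingCoeff_ne_zero.mpr hw0
    rw [← hmw]
    refine degree_sub_lt_left ?_ hw0 ?_
    · rw [smul_eq_C_mul, degree_C_mul hlc, hmw, hQdeg]
    · rw [smul_eq_C_mul, leadingCoeff_C_mul_of_isUnit hlc.isUnit, hQm, mul_one]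
  have horth : u (P m * w) = 0 := by
    have hlt : (P m).degree < n := by rw [hQdeg, ← hmw]; exact hwdeg
    rw [hw, mul_comm, sub_mul, map_sub, hP.map_mul_eq_zero hlt, hR.map_mul_eq_zero hlt, sub_zero]
  have hzero := hP.map_mul_eq_zero hlow
  rw [mul_sub, map_sub, horth, mul_smul_comm, map_smul, ← pow_two, zero_sub, neg_eq_zero,
    smul_eq_zero] at hzero
  exact hzero.elim (leadingCoeff_ne_zero.mpr hw0) (hP.2.2.2 m (by lia))

theorem map_smul_sub_smul_sub_smul (h : IsMOPS u P) (a b : ℂ) (n : ℤ) :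
    u (P n - a • P (n - 1) - b • P (n - 2)) =
      u 1 * (if n = 0 then 1 else if n = 1 then -a else if n = 2 then -b else 0) := by
  simp only [map_sub, map_smul, h.map_apply, smul_eq_mul]
  split_ifs <;> first | lia | ring

/-- The equation `a • P (n + 1) + b • P n = 0` forces both coefficients to vanish. -/
theorem coeff_eq_zero (h : IsMOPS u P) {a b : ℂ} {n : ℕ}
    (hab : a • P (n + 1 : ℕ) + b • P n = 0) : a = 0 ∧ b = 0 := by
  obtain ⟨hm, hd⟩ := h.monic_natDegree_natCast n
  obtain ⟨hm', hd'⟩ := h.monic_natDegree_natCast (n + 1)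
  have hc : (P n).coeff (n + 1) = 0 := coeff_eq_zero_of_natDegree_lt (by lia)
  have hc' : (P (n + 1 : ℕ)).coeff (n + 1) = 1 := by
    simpa only [Monic, leadingCoeff, hd'] using hm'
  have ha : a = 0 := by
    have := congrArg (fun p => p.coeff (n + 1)) hab
    simpa only [coeff_add, coeff_smul, smul_eq_mul, hc, hc', mul_one, mul_zero, add_zero,
      coeff_zero] using this
  refine ⟨ha, ?_⟩
  simpa [ha, hm.ne_zero] using hab

end IsMOPS

/-- Theorem 4.1 (i). -/
theorem stmt7
    (u0 u1 u : Polynomial ℂ →ₗ[ℂ] ℂ)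
    (P R Q : ℤ → Polynomial ℂ)
    (hP : IsMOPS u0 P) (hR : IsMOPS u1 R) (hQ : IsMOPS u Q)
    (hQdef : ∀ n : ℤ, 0 ≤ n → Q n = ((n : ℂ) + 1)⁻¹ • derivative (P (n + 1)))
    (d e σ τ : ℤ → ℂ)
    (hd : d (-1) = 0) (he1 : e (-1) = 0) (he2 : e (-2) = 0)
    (hσ : σ (-1) = 0) (hτ1 : τ (-1) = 0) (hτ2 : τ (-2) = 0)
    (h39 : ∀ n : ℤ, 0 ≤ n →
      R n - d (n - 1) • R (n - 1) - e (n - 2) • R (n - 2)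
        = Q n - σ (n - 1) • Q (n - 1) - τ (n - 2) • Q (n - 2))
    (hσ0 : σ 0 = d 0) (hτ0 : τ 0 = e 0) :
    (∀ n : ℤ, 0 ≤ n → R n = Q n) ∧
    (∀ n : ℤ, 1 ≤ n → σ n = d n ∧ τ n = e n) := by
  have hc1 := hR.map_one_ne_zero
  have hc := hQ.map_one_ne_zero
  have hvQ (n : ℕ) : (u 1 • u1 - u1 1 • u) (Q n) = 0 := by
    induction n using Nat.strong_induction_on with
    | _ n ih =>
    have hprev (k : ℤ) (hk : k < n) : (u 1 • u1 - u1 1 • u) (Q k) = 0 := by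
      rcases lt_or_ge k 0 with hneg | hpos
      · simp [hQ.1 k hneg]
      · lift k to ℕ using hpos
        exact ih k (by lia)
    have hA : (u 1 • u1 - u1 1 • u)
        (Q n - σ (n - 1) • Q (n - 1) - τ (n - 2) • Q (n - 2)) = 0 := by
      rw [LinearMap.sub_apply, LinearMap.smul_apply, LinearMap.smul_apply,
        hQ.map_smul_sub_smul_sub_smul, ← h39 n (by lia), hR.map_smul_sub_smul_sub_smul]
      split_ifs with h0 h1 h2
      · simp [mul_comm]
      · simp [h1, hσ0]; ring
      · simp [h2, hτ0]; ring
      · simp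
    simpa only [map_sub, map_smul, hprev (n - 1) (by lia), hprev (n - 2) (by lia), smul_zero,
      sub_zero] using hA
  have hu : u1 = (u1 1 / u 1) • u := by
    refine LinearMap.ext fun p => ?_
    have := LinearMap.eq_zero_of_degree_lt_of_monic_sequence (n := p.natDegree + 1)
      hQ.monic_natDegree_natCast (fun m _ => hvQ m)
      (degree_le_natDegree.trans_lt (by exact_mod_cast Nat.lt_succ_self _))
    simp only [LinearMap.sub_apply, LinearMap.smul_apply, smul_eq_mul] at this ⊢
    field_simp
    linear_combination this
  have hRQ (n : ℤ) (hn : 0 ≤ n) : R n = Q n := by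
    lift n to ℕ using hn
    exact hR.unique (hu ▸ hQ.smul (div_ne_zero hc1 hc)) n
  have hcoeff (n : ℕ) : σ (n + 1) = d (n + 1) ∧ τ n = e n := by
    have h := h39 (n + 2) (by lia)
    rw [show (n : ℤ) + 2 - 1 = n + 1 by ring, show (n : ℤ) + 2 - 2 = n by ring,
      hRQ _ (by lia), hRQ _ (by lia), hRQ _ (by lia)] at h
    have := hQ.coeff_eq_zero (n := n) (a := σ (n + 1) - d (n + 1)) (b := τ n - e n) (by
      push_cast
      rw [sub_smul, sub_smul]
      linear_combination h)
    exact ⟨sub_eq_zero.mp this.1, sub_eq_zero.mp this.2⟩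
  refine ⟨hRQ, fun n hn => ?_⟩
  obtain ⟨k, rfl⟩ : ∃ k : ℕ, n = k + 1 := ⟨(n - 1).toNat, by lia⟩
  exact ⟨(hcoeff k).1, by exact_mod_cast (hcoeff (k + 1)).2⟩
end
end

section
/- Let u0 and u1 be moment functionals on ℂ[x] with MOPS {P_n} and {R_n} respectively, set Q_n = P′_{n+1}/(n+1), and assume {Q_n} is an MOPS relative to some moment functional u. Assume the extended symmetric coherence relation: R_n − e_{n−2}R_{n−2} = Q_n − τ_{n−2}Q_{n−2} for all n ≥ 0, with e_{−1} = e_{−2} = τ_{−1} = τ_{−2} = 0 (i.e. relation (3.9) with σ_n = d_n = 0 for all n). If τ_0 = e_0, then R_n = Q_n for all n ≥ 0 and τ_n = e_n for all n ≥ 1. -/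
open Polynomial

noncomputable section

namespace IsMOPS

variable {u : Polynomial ℂ →ₗ[ℂ] ℂ} {P : ℤ → Polynomial ℂ}

theorem monic (h : IsMOPS u P) (n : ℕ) : (P n).Monic := (h.2.1 n (by positivity)).1

theorem degree_eq (h : IsMOPS u P) (n : ℕ) : (P n).degree = n := by
  rw [degree_eq_natDegree (h.monic n).ne_zero, (h.2.1 n (by positivity)).2, Int.toNat_natCast]

theorem map_mul_self_ne_zero (h : IsMOPS u P) (n : ℕ) : u (P n * P n) ≠ 0 := by
  simpa [sq] using h.2.2.2 n (by positivity)

theorem map_mul_eq_zero_of_ne (h : IsMOPS u P) {m n : ℕ} (hmn : m ≠ n) : u (P m * P n) = 0 :=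
  h.2.2.1 m n (by positivity) (by positivity) (by exact_mod_cast hmn)

/-- Subtracting the right multiple of `P n` lowers the degree. -/
theorem degree_sub_smul_lt (h : IsMOPS u P) {n : ℕ} {p : Polynomial ℂ}
    (hp : p.degree < ((n + 1 : ℕ) : WithBot ℕ)) : (p - p.coeff n • P n).degree < n := by
  have hcoeff : (P n).coeff n = 1 := by
    have hlead := h.monic n
    rwa [Monic, leadingCoeff, natDegree_eq_of_degree_eq_some (h.degree_eq n)] at hlead
  rw [degree_lt_iff_coeff_zero] at hp ⊢
  intro k hk
  rcases hk.eq_or_lt with rfl | hk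
  · simp [hcoeff]
  · have hz : (P n).coeff k = 0 :=
      coeff_eq_zero_of_degree_lt (by rw [h.degree_eq]; exact_mod_cast hk)
    simp [hp k hk, hz]

/-- `P m` is orthogonal to every polynomial of degree less than `m`. -/
theorem map_mul_eq_zero_of_degree_lt (h : IsMOPS u P) {m : ℕ} {p : Polynomial ℂ}
    (hp : p.degree < m) : u (P m * p) = 0 := by
  suffices H : ∀ n ≤ m, ∀ q : Polynomial ℂ, q.degree < n → u (P m * q) = 0 from H m le_rfl p hp
  intro n
  induction n with
  | zero =>
    intro _ q hq
    have hq0 : q = 0 := by simpa using hq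
    simp [hq0]
  | succ n ih =>
    intro hn q hq
    have hlow := ih (by omega) _ (h.degree_sub_smul_lt hq)
    have horth := h.map_mul_eq_zero_of_ne (show m ≠ n by omega)
    simpa [mul_sub, horth] using hlow

/-- A polynomial orthogonal to every `P k` with `k < n` and of degree less than `n` vanishes. -/
theorem eq_zero_of_forall_map_mul_eq_zero (h : IsMOPS u P) {n : ℕ} {p : Polynomial ℂ}
    (hp : p.degree < n) (horth : ∀ k < n, u (P k * p) = 0) : p = 0 := by
  induction n with
  | zero => simpa using hp
  | succ n ih =>
    have hlow := h.map_mul_eq_zero_of_degree_lt (h.degree_sub_smul_lt hp)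
    have hc : p.coeff n = 0 := by
      simpa [mul_sub, horth n n.lt_succ_self, h.map_mul_self_ne_zero n] using hlow
    have hdeg := h.degree_sub_smul_lt hp
    rw [hc, zero_smul, sub_zero] at hdeg
    exact ih hdeg fun k hk => horth k (by omega)

theorem degree_X_mul_sub_lt (h : IsMOPS u P) (n : ℕ) :
    (X * P n - P (n + 1 : ℕ)).degree < ((n + 1 : ℕ) : WithBot ℕ) := by
  have hdeg : (X * P n).degree = ((n + 1 : ℕ) : WithBot ℕ) := by
    rw [degree_mul, degree_X, h.degree_eq]; push_cast; ring
  rw [← hdeg]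
  refine degree_sub_lt_left (by rw [hdeg, h.degree_eq]) ?_ ?_
  · exact (monic_X.mul (h.monic n)).ne_zero
  · rw [(monic_X.mul (h.monic n)).leadingCoeff, (h.monic _).leadingCoeff]

theorem map_mul_X_mul (h : IsMOPS u P) (n : ℕ) :
    u (P (n + 1 : ℕ) * (X * P n)) = u (P (n + 1 : ℕ) * P (n + 1 : ℕ)) := by
  have hlow := h.map_mul_eq_zero_of_degree_lt (h.degree_X_mul_sub_lt n)
  rwa [mul_sub, map_sub, sub_eq_zero] at hlow

/-- The three-term recurrence relation. -/
theorem exists_recurrence (h : IsMOPS u P) (n : ℕ) :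
    ∃ b c : ℂ, X * P (n + 1 : ℕ) = P (n + 2 : ℕ) + b • P (n + 1 : ℕ) + c • P n := by
  refine ⟨u (P (n + 1 : ℕ) * (X * P (n + 1 : ℕ))) / u (P (n + 1 : ℕ) * P (n + 1 : ℕ)),
    u (P n * (X * P (n + 1 : ℕ))) / u (P n * P n), ?_⟩
  generalize hb : u (P (n + 1 : ℕ) * (X * P (n + 1 : ℕ))) / u (P (n + 1 : ℕ) * P (n + 1 : ℕ)) = b
  generalize hc : u (P n * (X * P (n + 1 : ℕ))) / u (P n * P n) = c
  rw [div_eq_iff (h.map_mul_self_ne_zero _)] at hb hc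
  rw [← sub_eq_zero]
  refine h.eq_zero_of_forall_map_mul_eq_zero (n := n + 2) ?_ fun k hk => ?_
  · have hsplit : X * P (n + 1 : ℕ) - (P (n + 2 : ℕ) + b • P (n + 1 : ℕ) + c • P n) =
        X * P (n + 1 : ℕ) - P (n + 2 : ℕ) - b • P (n + 1 : ℕ) - c • P n := by ring
    rw [hsplit]
    have hsmul : ∀ (a : ℂ) (k : ℕ), k < n + 2 →
        (a • P k).degree < ((n + 2 : ℕ) : WithBot ℕ) := fun a k hk =>
      (degree_smul_le _ _).trans_lt (by rw [h.degree_eq]; exact_mod_cast hk)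
    refine (degree_sub_le _ _).trans_lt (max_lt ((degree_sub_le _ _).trans_lt (max_lt ?_ ?_)) ?_)
    · exact h.degree_X_mul_sub_lt (n + 1)
    · exact hsmul _ _ (by omega)
    · exact hsmul _ _ (by omega)
  · have horth := h.map_mul_eq_zero_of_ne (show k ≠ n + 2 by omega)
    simp only [mul_sub, mul_add, mul_smul_comm, map_sub, map_add, map_smul, smul_eq_mul, horth]
    obtain hk | rfl | rfl : k < n ∨ k = n ∨ k = n + 1 := by omega
    · have hX : u (P k * (X * P (n + 1 : ℕ))) = 0 := by
        rw [show P k * (X * P (n + 1 : ℕ)) = P (n + 1 : ℕ) * (X * P k) by ring]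
        refine h.map_mul_eq_zero_of_degree_lt ?_
        rw [degree_mul, degree_X, h.degree_eq]
        norm_cast
        omega
      rw [hX, h.map_mul_eq_zero_of_ne (show k ≠ n + 1 by omega), h.map_mul_eq_zero_of_ne hk.ne]
      ring
    · rw [h.map_mul_eq_zero_of_ne (show k ≠ k + 1 by omega), ← hc]
      ring
    · rw [h.map_mul_eq_zero_of_ne (show n + 1 ≠ n by omega), ← hb]
      ring

/-- If `R (m + 2) = Q (m + 2)` and the next two members of `R` are perturbations of those of `Q`
by the members two degrees lower, then the first perturbation is trivial. -/
theorem perturbation_eq_zero {u v : Polynomial ℂ →ₗ[ℂ] ℂ} {Q R : ℤ → Polynomial ℂ}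
    (hQ : IsMOPS u Q) (hR : IsMOPS v R) {m : ℕ} {a a' : ℂ}
    (h2 : R (m + 2 : ℕ) = Q (m + 2 : ℕ))
    (h3 : R (m + 3 : ℕ) = Q (m + 3 : ℕ) + a • Q (m + 1 : ℕ))
    (h4 : R (m + 4 : ℕ) = Q (m + 4 : ℕ) + a' • Q (m + 2 : ℕ)) : a = 0 := by
  obtain ⟨b, c, hrec⟩ := hR.exists_recurrence (m + 2)
  rw [h2, h3, h4] at hrec
  have hu := congrArg (fun p => u (p * Q m)) hrec
  have hX3 : u (X * Q (m + 3 : ℕ) * Q m) = 0 := by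
    rw [show X * Q (m + 3 : ℕ) * Q m = Q (m + 3 : ℕ) * (X * Q m) by ring]
    refine hQ.map_mul_eq_zero_of_degree_lt ?_
    rw [degree_mul, degree_X, hQ.degree_eq]
    norm_cast
    omega
  have hX1 : u (X * Q (m + 1 : ℕ) * Q m) = u (Q (m + 1 : ℕ) * Q (m + 1 : ℕ)) := by
    rw [← hQ.map_mul_X_mul, mul_left_comm, mul_assoc]
  have horth : ∀ k : ℕ, k ≠ m → u (Q k * Q m) = 0 := fun k => hQ.map_mul_eq_zero_of_ne
  simp only [mul_add, add_mul, mul_smul_comm, smul_mul_assoc, smul_add, map_add, map_smul,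
    smul_eq_mul, hX3, hX1, horth (m + 1) (by omega), horth (m + 2) (by omega),
    horth (m + 3) (by omega), horth (m + 4) (by omega)] at hu
  simpa only [mul_zero, add_zero, zero_add, mul_eq_zero, hQ.map_mul_self_ne_zero, or_false]
    using hu

end IsMOPS

/-- Theorem 4.1 (iii). -/
theorem stmt9
    (u0 u1 u : Polynomial ℂ →ₗ[ℂ] ℂ)
    (P R Q : ℤ → Polynomial ℂ)
    (hP : IsMOPS u0 P) (hR : IsMOPS u1 R) (hQ : IsMOPS u Q)
    (hQdef : ∀ n : ℤ, 0 ≤ n → Q n = ((n : ℂ) + 1)⁻¹ • derivative (P (n + 1)))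
    (e τ : ℤ → ℂ) (he1 : e (-1) = 0) (he2 : e (-2) = 0)
    (hτ1 : τ (-1) = 0) (hτ2 : τ (-2) = 0)
    (hrel : ∀ n : ℤ, 0 ≤ n →
      R n - e (n - 2) • R (n - 2) = Q n - τ (n - 2) • Q (n - 2))
    (hτ0 : τ 0 = e 0) :
    (∀ n : ℤ, 0 ≤ n → R n = Q n) ∧ (∀ n : ℤ, 1 ≤ n → τ n = e n) := by
  have hstep : ∀ k : ℕ, R k = Q k →
      R (k + 2 : ℕ) = Q (k + 2 : ℕ) + (e k - τ k) • Q k := by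
    intro k hk
    have hk2 := hrel (k + 2 : ℕ) (by positivity)
    rw [show ((k + 2 : ℕ) : ℤ) - 2 = k by push_cast; ring, hk] at hk2
    rw [sub_smul]
    linear_combination hk2
  have hRQ : ∀ n : ℕ, R n = Q n := by
    intro n
    induction n using Nat.strong_induction_on with
    | _ n ih =>
      match n, ih with
      | 0, _ => simpa [he2, hτ2] using hrel 0 le_rfl
      | 1, _ => simpa [he1, hτ1] using hrel 1 zero_le_one
      | 2, ih => simpa [hτ0] using hstep 0 (ih 0 (by omega))
      | m + 3, ih =>
        have h3 := hstep (m + 1) (ih _ (by omega))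
        have h4 := hstep (m + 2) (ih _ (by omega))
        have ha := hQ.perturbation_eq_zero hR (ih (m + 2) (by omega)) h3 h4
        rw [h3, ha, zero_smul, add_zero]
  refine ⟨fun n hn => ?_, fun n hn => ?_⟩
  · lift n to ℕ using hn
    exact hRQ n
  · lift n to ℕ using by omega
    have hn2 := hstep n (hRQ n)
    rw [hRQ, left_eq_add, smul_eq_zero, sub_eq_zero] at hn2
    exact (hn2.resolve_right (hQ.monic n).ne_zero).symm
end
end
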